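/- arXiv:2510.00456 — 2 statements merged into one kernel-verified Lean document; each statement's English description precedes it below -/
import Mathlib

section
/- Let m ≥ 1, ε > 0, and α = (α₁,…,α_m) with each α_i ∈ (-1+ε, 1), and set |α| = Σ α_i. Then there exists a constant c > 0 (depending only on ε) such that for all t > 0, ∫_{T_m(t)} ∏_{i=1}^m (r_i − r_{i−1})^{α_i} dr ≤ c^m t^{|α|+m} / Γ(|α|+m+1), where T_m(t) = {0 < r₁ < r₂ < ⋯ < r_m < t} and r₀ = 0. -/
open MeasureTheory

/-- The simplex `0 < r₁ < ⋯ < r_m < t`. -/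
def openSimplex (m : ℕ) (t : ℝ) : Set (Fin m → ℝ) :=
  {r : Fin m → ℝ | (∀ i, 0 < r i ∧ r i < t) ∧ StrictMono r}

lemma val_sub_one_lt {m : ℕ} (i : Fin m) : (i : ℕ) - 1 < m :=
  (Nat.sub_le _ _).trans_lt i.isLt

/-- The increments `r i - r (i - 1)`, where `r (-1)` is read as `0`. -/
def increment {m : ℕ} (r : Fin m → ℝ) (i : Fin m) : ℝ :=
  r i - if _h : (i : ℕ) = 0 then 0 else r ⟨(i : ℕ) - 1, val_sub_one_lt i⟩

/-- The product of powers of increments, extended by zero outside the simplex. -/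
noncomputable def simplexKernel {m : ℕ} (α : Fin m → ℝ) (t : ℝ) : (Fin m → ℝ) → ENNReal :=
  (openSimplex m t).indicator fun r => ENNReal.ofReal (∏ i, increment r i ^ α i)

lemma measurableSet_openSimplex (m : ℕ) (t : ℝ) : MeasurableSet (openSimplex m t) := by
  have h : openSimplex m t =
      (⋂ i, {r | 0 < r i ∧ r i < t}) ∩ ⋂ i, ⋂ j, ⋂ _ : i < j, {r | r i < r j} := by
    ext r
    simp only [openSimplex, StrictMono, Set.mem_ofPred_eq, Set.mem_inter_iff, Set.mem_iInter]
  rw [h]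
  refine .inter (.iInter fun i => ?_) (.iInter fun i => .iInter fun j => .iInter fun _ => ?_)
  · exact (measurableSet_lt measurable_const (measurable_pi_apply i)).inter
      (measurableSet_lt (measurable_pi_apply i) measurable_const)
  · exact measurableSet_lt (measurable_pi_apply i) (measurable_pi_apply j)

lemma measurable_increment {m : ℕ} (i : Fin m) :
    Measurable fun r : Fin m → ℝ => increment r i := by
  unfold increment
  split_ifs <;> fun_prop

lemma measurable_prod_increment {m : ℕ} (α : Fin m → ℝ) :
    Measurable fun r : Fin m → ℝ => ∏ i, increment r i ^ α i :=
  Finset.measurable_fun_prod _ fun i _ => (measurable_increment i).pow_const (α i)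

lemma measurable_simplexKernel {m : ℕ} (α : Fin m → ℝ) (t : ℝ) :
    Measurable (simplexKernel α t) :=
  (measurable_prod_increment α).ennreal_ofReal.indicator (measurableSet_openSimplex m t)

lemma increment_pos {m : ℕ} {t : ℝ} {r : Fin m → ℝ} (hr : r ∈ openSimplex m t) (i : Fin m) :
    0 < increment r i := by
  unfold increment
  split_ifs with h
  · simpa using (hr.1 i).1
  · exact sub_pos.2 (hr.2 (Fin.lt_def.2 (by simp only; omega)))

lemma prod_increment_nonneg {m : ℕ} {t : ℝ} {r : Fin m → ℝ} (hr : r ∈ openSimplex m t)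
    (α : Fin m → ℝ) : 0 ≤ ∏ i, increment r i ^ α i :=
  Finset.prod_nonneg fun i _ => Real.rpow_nonneg (increment_pos hr i).le _

lemma increment_cons_zero {m : ℕ} (s : ℝ) (v : Fin m → ℝ) :
    increment (Fin.cons s v : Fin (m + 1) → ℝ) 0 = s := by
  simp [increment]

lemma increment_cons_succ {m : ℕ} (s : ℝ) (u : Fin m → ℝ) (i : Fin m) :
    increment (Fin.cons s (fun j => u j + s) : Fin (m + 1) → ℝ) i.succ = increment u i := by
  rcases m with _ | m
  · exact i.elim0
  refine Fin.cases ?_ (fun j => ?_) i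
  · simp [increment]
  · have h : (⟨(j.succ.succ : Fin (m + 2)).val - 1, by simp⟩ : Fin (m + 2)) =
        (Fin.succ ⟨j.succ.val - 1, val_sub_one_lt j.succ⟩) := by
      ext; simp
    simp only [increment, Fin.cons_succ, h]
    simp

lemma cons_mem_openSimplex_iff {m : ℕ} {t s : ℝ} {u : Fin m → ℝ} :
    (Fin.cons s (fun j => u j + s) : Fin (m + 1) → ℝ) ∈ openSimplex (m + 1) t ↔
      s ∈ Set.Ioo 0 t ∧ u ∈ openSimplex m (t - s) := by
  constructor
  · rintro ⟨h, hm⟩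
    refine ⟨by simpa using h 0, fun i => ⟨?_, ?_⟩, fun i j hij => ?_⟩
    · simpa using hm (Fin.succ_pos i)
    · have := (h i.succ).2
      simp only [Fin.cons_succ] at this
      linarith
    · simpa using hm (Fin.succ_lt_succ_iff.2 hij)
  · rintro ⟨hs, h, hm⟩
    refine ⟨fun i => ?_, fun i j hij => ?_⟩
    · refine Fin.cases (by simpa using hs) (fun j => ?_) i
      simp only [Fin.cons_succ]
      have := h j
      constructor <;> linarith [hs.1]
    · induction i using Fin.cases with
      | zero =>
        obtain ⟨k, rfl⟩ := Fin.exists_succ_eq.2 hij.ne'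
        simpa using (h k).1
      | succ i =>
        obtain ⟨k, rfl⟩ := Fin.exists_succ_eq.2 (Fin.ne_zero_of_lt hij)
        simpa using hm (Fin.succ_lt_succ_iff.1 hij)

lemma simplexKernel_cons {m : ℕ} (α : Fin (m + 1) → ℝ) (t s : ℝ) (u : Fin m → ℝ) :
    simplexKernel α t (Fin.cons s (fun j => u j + s)) =
      (Set.Ioo 0 t).indicator (fun s => ENNReal.ofReal (s ^ α 0)) s *
        simplexKernel (Fin.tail α) (t - s) u := by
  unfold simplexKernel
  by_cases hs : s ∈ Set.Ioo 0 t
  · by_cases hu : u ∈ openSimplex m (t - s)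
    · rw [Set.indicator_of_mem (cons_mem_openSimplex_iff.2 ⟨hs, hu⟩), Set.indicator_of_mem hs,
        Set.indicator_of_mem hu, ← ENNReal.ofReal_mul (Real.rpow_nonneg hs.1.le _),
        Fin.prod_univ_succ, increment_cons_zero]
      simp only [increment_cons_succ, Fin.tail]
    · rw [Set.indicator_of_notMem fun h => hu (cons_mem_openSimplex_iff.1 h).2,
        Set.indicator_of_notMem hu, mul_zero]
  · rw [Set.indicator_of_notMem fun h => hs (cons_mem_openSimplex_iff.1 h).1,
      Set.indicator_of_notMem hs, zero_mul]

lemma lintegral_simplexKernel_succ {m : ℕ} (α : Fin (m + 1) → ℝ) (t : ℝ) :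
    ∫⁻ r, simplexKernel α t r =
      ∫⁻ s in Set.Ioo 0 t, ENNReal.ofReal (s ^ α 0) *
        ∫⁻ u, simplexKernel (Fin.tail α) (t - s) u := by
  have he := (volume_preserving_piFinSuccAbove (fun _ : Fin (m + 1) => ℝ) 0).symm
  rw [← he.lintegral_comp (measurable_simplexKernel α t), Measure.volume_eq_prod,
    lintegral_prod (fun p => simplexKernel α t
      ((MeasurableEquiv.piFinSuccAbove (fun _ : Fin (m + 1) => ℝ) 0).symm p))
      ((measurable_simplexKernel α t).comp he.measurable).aemeasurable,
    ← lintegral_indicator measurableSet_Ioo]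
  refine lintegral_congr fun s => ?_
  rw [← lintegral_add_right_eq_self _ (fun _ : Fin m => s)]
  have h (u : Fin m → ℝ) : (MeasurableEquiv.piFinSuccAbove (fun _ : Fin (m + 1) => ℝ) 0).symm
      (s, u + fun _ => s) = Fin.cons s (fun j => u j + s) := by
    simp [MeasurableEquiv.piFinSuccAbove, Fin.insertNthEquiv]
    rfl
  simp only [h, simplexKernel_cons]
  rw [lintegral_const_mul _ (measurable_simplexKernel _ _)]
  by_cases hs : s ∈ Set.Ioo 0 t <;> simp [hs, Set.indicator]

lemma lintegral_rpow_mul_sub_rpow {a b t : ℝ} (ha : -1 < a) (hb : -1 < b) (ht : 0 < t) :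
    ∫⁻ s in Set.Ioo 0 t, ENNReal.ofReal (s ^ a * (t - s) ^ b) =
      ENNReal.ofReal (t ^ (a + b + 1) *
        (Real.Gamma (a + 1) * Real.Gamma (b + 1) / Real.Gamma (a + b + 2))) := by
  have hB : 0 < ProbabilityTheory.beta (a + 1) (b + 1) :=
    ProbabilityTheory.beta_pos (by linarith) (by linarith)
  have hpt (s : ℝ) : (Set.Ioo 0 t).indicator (fun s => ENNReal.ofReal (s ^ a * (t - s) ^ b)) s =
      ENNReal.ofReal (t ^ (a + b) * ProbabilityTheory.beta (a + 1) (b + 1)) *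
        ProbabilityTheory.betaPDF (a + 1) (b + 1) (t⁻¹ * s) := by
    by_cases hs : s ∈ Set.Ioo 0 t
    · have h1 : t⁻¹ * s < 1 := by
        rw [inv_mul_lt_iff₀ ht]; simpa using hs.2
      rw [Set.indicator_of_mem hs, ProbabilityTheory.betaPDF_of_pos_lt_one
        (mul_pos (inv_pos.2 ht) hs.1) h1, ← ENNReal.ofReal_mul (by positivity)]
      have h2 : s ^ a = t ^ a * (t⁻¹ * s) ^ a := by
        rw [← Real.mul_rpow ht.le (mul_pos (inv_pos.2 ht) hs.1).le, mul_inv_cancel_left₀ ht.ne']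
      have h3 : (t - s) ^ b = t ^ b * (1 - t⁻¹ * s) ^ b := by
        rw [← Real.mul_rpow ht.le (by linarith), mul_sub, mul_inv_cancel_left₀ ht.ne', mul_one]
      rw [h2, h3, Real.rpow_add ht, add_sub_cancel_right, add_sub_cancel_right]
      congr 1
      field_simp
    · rw [Set.indicator_of_notMem hs, ProbabilityTheory.betaPDF_eq, if_neg, ENNReal.ofReal_zero,
        mul_zero]
      rintro ⟨h1, h2⟩
      rw [inv_mul_lt_iff₀ ht, mul_one] at h2
      exact hs ⟨pos_of_mul_pos_right h1 (inv_pos.2 ht).le, h2⟩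
  have hmeas : Measurable (ProbabilityTheory.betaPDF (a + 1) (b + 1)) :=
    (ProbabilityTheory.measurable_betaPDFReal _ _).ennreal_ofReal
  rw [← lintegral_indicator measurableSet_Ioo, lintegral_congr hpt,
    lintegral_const_mul _ (by fun_prop),
    ← lintegral_map hmeas (measurable_const_mul t⁻¹),
    Real.map_volume_mul_left (inv_ne_zero ht.ne'), lintegral_smul_measure,
    ProbabilityTheory.lintegral_betaPDF_eq_one (by linarith) (by linarith), inv_inv,
    abs_of_pos ht, smul_eq_mul, mul_one, ← ENNReal.ofReal_mul (by positivity),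
    ProbabilityTheory.beta, Real.rpow_add_one ht.ne', show a + 1 + (b + 1) = a + b + 2 by ring]
  congr 1
  ring

lemma neg_one_lt_sum_add_card {m : ℕ} {α : Fin m → ℝ} (hα : ∀ i, -1 < α i) :
    -1 < ∑ i, α i + m := by
  have h : ∑ _i : Fin m, (-1 : ℝ) ≤ ∑ i, α i := Finset.sum_le_sum fun i _ => (hα i).le
  simp only [Finset.sum_const, Finset.card_univ, Fintype.card_fin, nsmul_eq_mul] at h
  linarith

/-- The Dirichlet integral over the simplex. -/
lemma lintegral_simplexKernel {m : ℕ} (α : Fin m → ℝ) (hα : ∀ i, -1 < α i) {t : ℝ} (ht : 0 < t) :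
    ∫⁻ r, simplexKernel α t r =
      ENNReal.ofReal ((∏ i, Real.Gamma (α i + 1)) * t ^ (∑ i, α i + m) /
        Real.Gamma (∑ i, α i + m + 1)) := by
  induction m generalizing t with
  | zero =>
    have h : simplexKernel α t = fun _ => 1 := by
      funext r
      have hr : r ∈ openSimplex 0 t := ⟨fun i => i.elim0, fun i => i.elim0⟩
      rw [simplexKernel, Set.indicator_of_mem hr]
      simp
    rw [h]
    simp [volume_pi]
  | succ m ih =>
    have hα' (i : Fin m) : -1 < Fin.tail α i := hα i.succ
    have hb := neg_one_lt_sum_add_card hα'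
    have hsum : ∑ i, α i + ((m + 1 : ℕ) : ℝ) = α 0 + (∑ i, Fin.tail α i + m) + 1 := by
      rw [Fin.sum_univ_succ]; push_cast; simp only [Fin.tail]; ring
    have hprod : ∏ i, Real.Gamma (α i + 1) =
        Real.Gamma (α 0 + 1) * ∏ i, Real.Gamma (Fin.tail α i + 1) := Fin.prod_univ_succ _
    set b := ∑ i, Fin.tail α i + m
    have hΓ : 0 < Real.Gamma (b + 1) := Real.Gamma_pos_of_pos (by linarith)
    have hP : 0 ≤ ∏ i, Real.Gamma (Fin.tail α i + 1) :=
      Finset.prod_nonneg fun i _ => (Real.Gamma_pos_of_pos (by linarith [hα' i])).le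
    have hint : ∀ s ∈ Set.Ioo 0 t, ENNReal.ofReal (s ^ α 0) *
        ∫⁻ u, simplexKernel (Fin.tail α) (t - s) u =
        ENNReal.ofReal ((∏ i, Real.Gamma (Fin.tail α i + 1)) / Real.Gamma (b + 1)) *
          ENNReal.ofReal (s ^ α 0 * (t - s) ^ b) := by
      intro s hs
      rw [ih _ hα' (sub_pos.2 hs.2), ← ENNReal.ofReal_mul (Real.rpow_nonneg hs.1.le _),
        ← ENNReal.ofReal_mul (by positivity)]
      congr 1
      ring
    rw [lintegral_simplexKernel_succ, setLIntegral_congr_fun measurableSet_Ioo hint,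
      lintegral_const_mul _ (by fun_prop), lintegral_rpow_mul_sub_rpow (hα 0) hb ht,
      ← ENNReal.ofReal_mul (by positivity), hprod, hsum, add_assoc (α 0 + b) 1 1, one_add_one_eq_two]
    congr 1
    field_simp

lemma setIntegral_openSimplex {m : ℕ} (α : Fin m → ℝ) (hα : ∀ i, -1 < α i) {t : ℝ} (ht : 0 < t) :
    ∫ r in openSimplex m t, ∏ i, increment r i ^ α i =
      (∏ i, Real.Gamma (α i + 1)) * t ^ (∑ i, α i + m) / Real.Gamma (∑ i, α i + m + 1) := by
  rw [integral_eq_lintegral_of_nonneg_ae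
      ((ae_restrict_iff' (measurableSet_openSimplex m t)).2
        (.of_forall fun r hr => prod_increment_nonneg hr α))
      (measurable_prod_increment α).aestronglyMeasurable,
    ← lintegral_indicator (measurableSet_openSimplex m t)]
  refine (congrArg ENNReal.toReal (lintegral_simplexKernel α hα ht)).trans
    (ENNReal.toReal_ofReal ?_)
  have hΓ : 0 < Real.Gamma (∑ i, α i + m + 1) :=
    Real.Gamma_pos_of_pos (by linarith [neg_one_lt_sum_add_card hα])
  have hP : 0 ≤ ∏ i, Real.Gamma (α i + 1) :=
    Finset.prod_nonneg fun i _ => (Real.Gamma_pos_of_pos (by linarith [hα i])).le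
  positivity

theorem stmt2 (ε : ℝ) (hε : 0 < ε) :
    ∃ c > 0, ∀ (m : ℕ), 1 ≤ m → ∀ α : Fin m → ℝ,
      (∀ i, α i ∈ Set.Ioo (-1 + ε) 1) → ∀ t > (0 : ℝ),
      (∫ r in {r : Fin m → ℝ | (∀ i, 0 < r i ∧ r i < t) ∧ StrictMono r},
          ∏ i, (r i - if h : (i : ℕ) = 0 then 0
              else r ⟨(i : ℕ) - 1, by have := i.isLt; omega⟩) ^ (α i)) ≤
        c ^ m * t ^ (∑ i, α i + m) / Real.Gamma (∑ i, α i + m + 1) := by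
  refine ⟨max (Real.Gamma ε) (Real.Gamma 2),
    lt_max_of_lt_left (Real.Gamma_pos_of_pos hε), fun m _ α hα t ht => ?_⟩
  have hα' (i : Fin m) : -1 < α i := by linarith [(hα i).1]
  refine (setIntegral_openSimplex α hα' ht).trans_le ?_
  have hΓ : 0 < Real.Gamma (∑ i, α i + m + 1) :=
    Real.Gamma_pos_of_pos (by linarith [neg_one_lt_sum_add_card hα'])
  have hP : ∏ i, Real.Gamma (α i + 1) ≤ max (Real.Gamma ε) (Real.Gamma 2) ^ m := by
    refine (Finset.prod_le_prod
      (fun i _ => (Real.Gamma_pos_of_pos (by linarith [hα' i])).le) fun i _ => ?_).trans_eq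
      (Fin.prod_const m (max (Real.Gamma ε) (Real.Gamma 2)))
    exact Real.convexOn_Gamma.le_max_of_mem_Icc (Set.mem_Ioi.2 hε) (Set.mem_Ioi.2 two_pos)
      ⟨by linarith [(hα i).1], by linarith [(hα i).2]⟩
  gcongr
end

section
/- Let Y, X₁, …, X_n be random variables on a common probability space. Then σ(Y) is independent of σ(X₁, …, X_n) if and only if Y is independent of every linear combination a₁X₁ + ⋯ + a_nX_n with real coefficients. -/
open MeasureTheory ProbabilityTheory

/-- A random variable is independent of a random vector as soon as it is independent of the image
of that vector under every continuous linear form. -/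
lemma ProbabilityTheory.indepFun_iff_forall_strongDual {Ω E F : Type*} {mΩ : MeasurableSpace Ω}
    {P : Measure Ω} [IsFiniteMeasure P]
    {mE : MeasurableSpace E} [NormedAddCommGroup E] [NormedSpace ℝ E] [CompleteSpace E]
    [BorelSpace E] [SecondCountableTopology E]
    {mF : MeasurableSpace F} [NormedAddCommGroup F] [NormedSpace ℝ F] [CompleteSpace F]
    [BorelSpace F] [SecondCountableTopology F]
    {X : Ω → E} {Y : Ω → F} (hX : AEMeasurable X P) (hY : AEMeasurable Y P) :
    IndepFun X Y P ↔ ∀ L : StrongDual ℝ F, IndepFun X (fun ω ↦ L (Y ω)) P := by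
  refine ⟨fun h L ↦ h.comp measurable_id L.measurable, fun h ↦ ?_⟩
  rw [indepFun_iff_charFunDual_prod hX hY]
  intro L
  simp only [charFunDual_apply]
  rw [integral_map (by fun_prop) (by fun_prop), integral_map hX (by fun_prop),
    integral_map hY (by fun_prop)]
  have hprod := (h (L.comp (.inr ℝ E F))).integral_fun_comp_mul_comp
    (f := fun x ↦ Complex.exp (L.comp (.inl ℝ E F) x * Complex.I))
    (g := fun z : ℝ ↦ Complex.exp (z * Complex.I)) hX (by fun_prop) (by fun_prop) (by fun_prop)
  rw [← hprod]
  congr with ω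
  rw [← Complex.exp_add, ← add_mul, ← Complex.ofReal_add, ContinuousLinearMap.comp_apply,
    ContinuousLinearMap.comp_apply, ← map_add]
  simp

theorem stmt9 {Ω : Type*} {mΩ : MeasurableSpace Ω} {μ : Measure Ω}
    [IsProbabilityMeasure μ]
    (n : ℕ) (Y : Ω → ℝ) (X : Fin n → Ω → ℝ)
    (hY : Measurable Y) (hX : ∀ i, Measurable (X i))
    (hGauss : ∀ c : ℝ, ∀ a : Fin n → ℝ, ∃ m : ℝ, ∃ s : NNReal,
      Measure.map (fun ω => c * Y ω + ∑ i, a i * X i ω) μ = gaussianReal m s) :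
    Indep (MeasurableSpace.comap Y inferInstance)
        (⨆ i, MeasurableSpace.comap (X i) inferInstance) μ ↔
      ∀ a : Fin n → ℝ, IndepFun Y (fun ω => ∑ i, a i * X i ω) μ := by
  rw [← MeasurableSpace.comap_process_pi, ← IndepFun_iff_Indep]
  constructor
  · intro h a
    exact h.comp (φ := id) (ψ := fun x : Fin n → ℝ ↦ ∑ i, a i * x i) measurable_id (by fun_prop)
  · intro h
    rw [indepFun_iff_forall_strongDual hY.aemeasurable (by fun_prop)]
    intro L
    convert h (fun i ↦ L (fun j ↦ if i = j then 1 else 0)) using 2 with ω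
    simpa [mul_comm] using L.toLinearMap.pi_apply_eq_sum_univ (fun i ↦ X i ω)
end
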